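/- Let W be a real normed vector space equipped with a continuous map W × [0,∞) → W, (u,t) ↦ u_t, satisfying (H1) (u_{t1})_{t2} = u_{t1·t2} for all u ∈ W and t1, t2 ≥ 0, and (H3) u_0 = 0 and u_1 = u for all u ∈ W. Let s > 0 and let I : W → ℝ be continuous, even, coercive, with I(0) = 0, I(u) > 0 for u ≠ 0, I(u_t) = t^s·I(u) for all u, t, and such that for every u ≠ 0 the map t ↦ I(t·u) is strictly increasing on (0,∞). Set M = {u ∈ W : I(u) = 1}, let π_rad be the radial projection onto M, let A_0 ⊆ M be nonempty and symmetric, w̃ ∈ M ∖ A_0, A_1 = {π_rad((1−τ)·v + τ·w̃) : v ∈ A_0, 0 ≤ τ ≤ 1}, and let 0 ≤ r < R. Then the set A* = {u_t : u ∈ A_1, r ≤ t ≤ R}, with the subspace topology, is contractible. -/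

import Mathlib

open Set Topology

/-- A set in which every point can be deformed inside the set to a fixed point, jointly
continuously in time and position, is contractible. -/
theorem contractibleSpace_of_continuousOn_deformation {X : Type*} [TopologicalSpace X]
    {S : Set X} {c : X} (hc : c ∈ S) (F : ℝ × X → X)
    (hF : ContinuousOn F (Icc 0 1 ×ˢ S)) (hmaps : MapsTo F (Icc 0 1 ×ˢ S) S)
    (h0 : ∀ x ∈ S, F (0, x) = x) (h1 : ∀ x ∈ S, F (1, x) = c) :
    ContractibleSpace S := by
  rw [contractible_iff_id_nullhomotopic]
  refine ⟨⟨c, hc⟩, ⟨{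
    toFun := fun p => ⟨F (p.1, p.2), hmaps ⟨p.1.2, p.2.2⟩⟩
    continuous_toFun := ?_
    map_zero_left := fun x => Subtype.ext (by simpa using h0 x x.2)
    map_one_left := fun x => Subtype.ext (by simpa using h1 x x.2) }⟩⟩
  refine Continuous.subtype_mk ?_ _
  exact hF.comp_continuous (f := fun p : unitInterval × S => ((p.1 : ℝ), (p.2 : X)))
    (by fun_prop) (fun p => ⟨p.1.2, p.2.2⟩)

section RadialProjection

variable {W : Type*} [NormedAddCommGroup W] [NormedSpace ℝ W] {I : W → ℝ} {T : W → ℝ}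

theorem eq_radial_factor
    (hImono : ∀ u : W, u ≠ 0 → StrictMonoOn (fun t : ℝ => I (t • u)) (Ioi (0:ℝ)))
    (hT : ∀ u : W, u ≠ 0 → 0 < T u ∧ I (T u • u) = 1)
    {u : W} (hu : u ≠ 0) {c : ℝ} (hc : 0 < c) (h : I (c • u) = 1) : T u = c :=
  (hImono u hu).injOn (hT u hu).1 hc ((hT u hu).2.trans h.symm)

theorem radial_projection_smul
    (hImono : ∀ u : W, u ≠ 0 → StrictMonoOn (fun t : ℝ => I (t • u)) (Ioi (0:ℝ)))
    (hT : ∀ u : W, u ≠ 0 → 0 < T u ∧ I (T u • u) = 1)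
    {u : W} (hu : u ≠ 0) {c : ℝ} (hc : 0 < c) : T (c • u) • (c • u) = T u • u := by
  have hcu : c • u ≠ 0 := smul_ne_zero hc.ne' hu
  obtain ⟨hpos, hval⟩ := hT (c • u) hcu
  rw [smul_smul] at hval ⊢
  rw [eq_radial_factor hImono hT hu (mul_pos hpos hc) hval]

theorem continuousOn_radial_factor (hIcont : Continuous I)
    (hImono : ∀ u : W, u ≠ 0 → StrictMonoOn (fun t : ℝ => I (t • u)) (Ioi (0:ℝ)))
    (hT : ∀ u : W, u ≠ 0 → 0 < T u ∧ I (T u • u) = 1) :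
    ContinuousOn T {0}ᶜ := by
  intro u hu
  have hne : ∀ᶠ v in 𝓝[{0}ᶜ] u, v ≠ 0 := eventually_mem_nhdsWithin
  obtain ⟨hpos, hval⟩ := hT u hu
  refine tendsto_order.2 ⟨fun a ha => ?_, fun b hb => ?_⟩
  · rcases le_or_gt a 0 with ha0 | ha0
    · filter_upwards [hne] with v hv using ha0.trans_lt (hT v hv).1
    · have hlt : I (a • u) < 1 := hval ▸ hImono u hu ha0 hpos ha
      have hcont : Continuous fun v => I (a • v) := by fun_prop
      have hev : ∀ᶠ v in 𝓝[{0}ᶜ] u, I (a • v) < 1 :=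
        nhdsWithin_le_nhds (hcont.continuousAt.eventually_lt_const hlt)
      filter_upwards [hne, hev] with v hv hlt'
      rw [← (hT v hv).2] at hlt'
      exact ((hImono v hv).lt_iff_lt ha0 (hT v hv).1).1 hlt'
  · have hb0 : 0 < b := hpos.trans hb
    have hlt : 1 < I (b • u) := hval ▸ hImono u hu hpos hb0 hb
    have hcont : Continuous fun v => I (b • v) := by fun_prop
    have hev : ∀ᶠ v in 𝓝[{0}ᶜ] u, 1 < I (b • v) :=
      nhdsWithin_le_nhds (hcont.continuousAt.eventually_const_lt hlt)
    filter_upwards [hne, hev] with v hv hlt'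
    rw [← (hT v hv).2] at hlt'
    exact ((hImono v hv).lt_iff_lt (hT v hv).1 hb0).1 hlt'

/-- A segment joining two points of the level set `I = 1` that are not antipodal avoids `0`. -/
theorem segment_ne_zero (hIeven : ∀ u : W, I (-u) = I u) (hI0 : I 0 = 0)
    (hImono : ∀ u : W, u ≠ 0 → StrictMonoOn (fun t : ℝ => I (t • u)) (Ioi (0:ℝ)))
    {v w : W} (hv : I v = 1) (hw : I w = 1) (hvw : v ≠ -w) {τ : ℝ} (hτ : τ ∈ Icc (0:ℝ) 1) :
    (1 - τ) • v + τ • w ≠ 0 := by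
  have hv0 : v ≠ 0 := by rintro rfl; simp [hI0] at hv
  have hw0 : w ≠ 0 := by rintro rfl; simp [hI0] at hw
  intro h
  rcases hτ.1.eq_or_lt with rfl | h0
  · simp [hv0] at h
  rcases hτ.2.eq_or_lt with rfl | h1
  · simp [hw0] at h
  have hpos : 0 < 1 - τ := sub_pos.2 h1
  have hveq : v = -((τ / (1 - τ)) • w) := by
    have : (1 - τ) • v = (1 - τ) • -((τ / (1 - τ)) • w) := by
      rw [smul_neg, smul_smul, mul_div_cancel₀ _ hpos.ne']
      exact eq_neg_of_add_eq_zero_left h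
    exact smul_right_injective W hpos.ne' this
  have hval : I ((τ / (1 - τ)) • w) = 1 := by rw [← hIeven, ← hveq, hv]
  have hone : τ / (1 - τ) = 1 :=
    (hImono w hw0).injOn (div_pos h0 hpos) (mem_Ioi.2 one_pos) (by simp [hval, hw])
  exact hvw (by rw [hveq, hone, one_smul])

end RadialProjection


/-- A* = {u_t : u ∈ A₁, r ≤ t ≤ R} is contractible. -/
theorem stmt_11 {W : Type*} [NormedAddCommGroup W] [NormedSpace ℝ W]
    (sc : W → ℝ → W)
    (hsc_cont : ContinuousOn (fun p : W × ℝ => sc p.1 p.2) (Set.univ ×ˢ Set.Ici (0:ℝ)))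
    (hH1 : ∀ (u : W) (t1 t2 : ℝ), 0 ≤ t1 → 0 ≤ t2 → sc (sc u t1) t2 = sc u (t1 * t2))
    (hH3a : ∀ u : W, sc u 0 = 0) (hH3b : ∀ u : W, sc u 1 = u)
    (s : ℝ) (hs : 0 < s)
    (I : W → ℝ) (hIcont : Continuous I) (hIeven : ∀ u : W, I (-u) = I u)
    (hIcoercive : ∀ c : ℝ, ∃ R : ℝ, ∀ u : W, R ≤ ‖u‖ → c ≤ I u)
    (hI0 : I 0 = 0) (hIpos : ∀ u : W, u ≠ 0 → 0 < I u)
    (hIscale : ∀ (u : W) (t : ℝ), 0 ≤ t → I (sc u t) = t ^ s * I u)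
    (hImono : ∀ u : W, u ≠ 0 → StrictMonoOn (fun t : ℝ => I (t • u)) (Set.Ioi (0:ℝ)))
    (T : W → ℝ) (hT : ∀ u : W, u ≠ 0 → 0 < T u ∧ I (T u • u) = 1)
    (A0 : Set W) (hA0M : A0 ⊆ {u : W | I u = 1}) (hA0ne : A0.Nonempty)
    (hA0sym : ∀ u ∈ A0, -u ∈ A0)
    (w : W) (hwM : I w = 1) (hw : w ∉ A0)
    (A1 : Set W)
    (hA1 : A1 = {x : W | ∃ v ∈ A0, ∃ τ ∈ Set.Icc (0:ℝ) 1,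
      x = T ((1-τ) • v + τ • w) • ((1-τ) • v + τ • w)})
    (r R : ℝ) (hr : 0 ≤ r) (hrR : r < R)
    (Astar : Set W)
    (hAstar : Astar = {x : W | ∃ u ∈ A1, ∃ t : ℝ, r ≤ t ∧ t ≤ R ∧ x = sc u t}) :
    ContractibleSpace ↥Astar := by
  have hw0 : w ≠ 0 := by rintro rfl; simp [hI0] at hwM
  have hanti : ∀ v ∈ A0, v ≠ -w := fun v hv h => hw (by simpa [h] using hA0sym v hv)
  have hseg : ∀ v ∈ A0, ∀ τ ∈ Icc (0:ℝ) 1, (1 - τ) • v + τ • w ≠ 0 := fun v hv τ hτ =>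
    segment_ne_zero hIeven hI0 hImono (hA0M hv) hwM (hanti v hv) hτ
  have hI1 : ∀ u ∈ A1, I u = 1 := by
    rw [hA1]
    rintro _ ⟨v, hv, τ, hτ, rfl⟩
    exact (hT _ (hseg v hv τ hτ)).2
  have hTw : T w • w = w := by
    rw [eq_radial_factor hImono hT hw0 one_pos (by simpa using hwM), one_smul]
  have hwA1 : w ∈ A1 := by
    obtain ⟨v, hv⟩ := hA0ne
    rw [hA1]
    exact ⟨v, hv, 1, by simp, by simp [hTw]⟩
  have hstar : ∀ u ∈ A1, ∀ t, r ≤ t → t ≤ R → sc u t ∈ Astar := by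
    intro u hu t h1 h2
    rw [hAstar]
    exact ⟨u, hu, t, h1, h2, rfl⟩
  rcases hr.eq_or_lt with rfl | hr0
  · refine contractibleSpace_of_continuousOn_deformation (c := 0)
      (by simpa [hH3a] using hstar w hwA1 0 le_rfl hrR.le) (fun p => sc p.2 (1 - p.1)) ?_ ?_
      (fun x _ => by simp [hH3b]) (fun x _ => by simp [hH3a])
    · exact hsc_cont.comp (f := fun p : ℝ × W => (p.2, 1 - p.1)) (by fun_prop)
        (fun p hp => ⟨mem_univ _, sub_nonneg.2 hp.1.2⟩)
    · rintro ⟨σ, x⟩ ⟨hσ, hx⟩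
      rw [hAstar] at hx
      obtain ⟨u, hu, t, ht0, htR, rfl⟩ := hx
      have hσ' : 0 ≤ 1 - σ := sub_nonneg.2 hσ.2
      show sc (sc u t) (1 - σ) ∈ Astar
      rw [hH1 _ _ _ ht0 hσ']
      refine hstar u hu _ (mul_nonneg ht0 hσ') ((mul_le_of_le_one_right ht0 ?_).trans htR)
      linarith [hσ.1]
  have hjoin : ∀ u ∈ A1, ∀ σ ∈ Icc (0:ℝ) 1, (1 - σ) • u + σ • w ≠ 0 ∧
      T ((1 - σ) • u + σ • w) • ((1 - σ) • u + σ • w) ∈ A1 := by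
    rw [hA1]
    rintro _ ⟨v, hv, τ, hτ, rfl⟩ σ hσ
    set k := T ((1 - τ) • v + τ • w)
    have hk : 0 < k := (hT _ (hseg v hv τ hτ)).1
    set c := (1 - σ) * k + σ with hcdef
    have hc : 0 < c := by
      rcases hσ.1.eq_or_lt with h | h
      · simp [hcdef, ← h, hk]
      · have := mul_nonneg (sub_nonneg.2 hσ.2) hk.le
        linarith
    have hσk : 0 ≤ (1 - σ) * k := mul_nonneg (sub_nonneg.2 hσ.2) hk.le
    set ρ := ((1 - σ) * k * τ + σ) / c with hρdef
    have hcρ : c * ρ = (1 - σ) * k * τ + σ := mul_div_cancel₀ _ hc.ne'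
    have hρ : ρ ∈ Icc (0:ℝ) 1 := by
      refine ⟨div_nonneg (add_nonneg (mul_nonneg hσk hτ.1) hσ.1) hc.le, ?_⟩
      rw [hρdef, div_le_one hc]
      linarith [mul_le_of_le_one_right hσk hτ.2]
    have heq : (1 - σ) • k • ((1 - τ) • v + τ • w) + σ • w = c • ((1 - ρ) • v + ρ • w) := by
      have hcρ' : c * (1 - ρ) = (1 - σ) * k * (1 - τ) := by
        rw [mul_sub, hcρ, hcdef]; ring
      rw [smul_add c, smul_smul c, smul_smul c, hcρ, hcρ']
      module
    rw [heq]
    refine ⟨smul_ne_zero hc.ne' (hseg v hv ρ hρ), v, hv, ρ, hρ, ?_⟩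
    exact radial_projection_smul hImono hT (hseg v hv ρ hρ) hc
  set θ : W → ℝ := fun x => I x ^ (1 / s)
  have hθ : ∀ u ∈ A1, ∀ t, 0 ≤ t → θ (sc u t) = t := by
    intro u hu t ht
    simp only [θ, hIscale u t ht, hI1 u hu, mul_one]
    rw [← Real.rpow_mul ht, mul_one_div_cancel hs.ne', Real.rpow_one]
  have hback : ∀ u ∈ A1, ∀ t, 0 < t → sc (sc u t) (θ (sc u t))⁻¹ = u := by
    intro u hu t ht
    rw [hθ u hu t ht.le, hH1 _ _ _ ht.le (inv_pos.2 ht).le, mul_inv_cancel₀ ht.ne', hH3b]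
  have hpolar : ∀ x ∈ Astar, r ≤ θ x ∧ θ x ≤ R ∧ sc x (θ x)⁻¹ ∈ A1 ∧
      sc (sc x (θ x)⁻¹) (θ x) = x := by
    rw [hAstar]
    rintro _ ⟨u, hu, t, htr, htR, rfl⟩
    have ht : 0 < t := hr0.trans_le htr
    rw [hback u hu t ht, hθ u hu t ht.le]
    exact ⟨htr, htR, hu, rfl⟩
  have hθcont : Continuous θ := hIcont.rpow_const fun _ => Or.inr (one_div_pos.2 hs).le
  set j : ℝ × W → W := fun p => (1 - p.1) • sc p.2 (θ p.2)⁻¹ + p.1 • w with hj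
  have hjcont : ContinuousOn j (Icc 0 1 ×ˢ Astar) := by
    have hinv : ContinuousOn (fun p : ℝ × W => (θ p.2)⁻¹) (Icc 0 1 ×ˢ Astar) :=
      ContinuousOn.inv₀ (by fun_prop) fun p hp => (hr0.trans_le (hpolar p.2 hp.2).1).ne'
    have hsc : ContinuousOn (fun p : ℝ × W => sc p.2 (θ p.2)⁻¹) (Icc 0 1 ×ˢ Astar) :=
      hsc_cont.comp (f := fun p : ℝ × W => (p.2, (θ p.2)⁻¹)) (continuousOn_snd.prodMk hinv)
        fun p hp => ⟨mem_univ _, inv_nonneg.2 (hr0.le.trans (hpolar p.2 hp.2).1)⟩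
    exact ((continuousOn_const.sub continuousOn_fst).smul hsc).add
      (continuousOn_fst.smul continuousOn_const)
  have hjA1 : ∀ p ∈ Icc (0:ℝ) 1 ×ˢ Astar, j p ≠ 0 ∧ T (j p) • j p ∈ A1 := fun p hp =>
    hjoin _ (hpolar p.2 hp.2).2.2.1 p.1 hp.1
  have hTj : ContinuousOn (fun p => T (j p)) (Icc 0 1 ×ˢ Astar) :=
    (continuousOn_radial_factor hIcont hImono hT).comp hjcont fun p hp => (hjA1 p hp).1
  have hbetween : ∀ p ∈ Icc (0:ℝ) 1 ×ˢ Astar,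
      (1 - p.1) * θ p.2 + p.1 * R ∈ Icc r R := fun p hp =>
    (convex_Icc r R) ⟨(hpolar p.2 hp.2).1, (hpolar p.2 hp.2).2.1⟩ ⟨hrR.le, le_rfl⟩
      (sub_nonneg.2 hp.1.2) hp.1.1 (by ring)
  refine contractibleSpace_of_continuousOn_deformation (c := sc w R)
    (hstar w hwA1 R hrR.le le_rfl)
    (fun p => sc (T (j p) • j p) ((1 - p.1) * θ p.2 + p.1 * R)) ?_ ?_ ?_ ?_
  · exact hsc_cont.comp
      (f := fun p : ℝ × W => (T (j p) • j p, (1 - p.1) * θ p.2 + p.1 * R))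
      ((hTj.smul hjcont).prodMk (by fun_prop))
      fun p hp => ⟨mem_univ _, hr.trans (hbetween p hp).1⟩
  · exact fun p hp => hstar _ (hjA1 p hp).2 _ (hbetween p hp).1 (hbetween p hp).2
  · intro x hx
    obtain ⟨-, -, hu, hxx⟩ := hpolar x hx
    have hu1 := hI1 _ hu
    have hu0 : sc x (θ x)⁻¹ ≠ 0 := by intro h; simp [h, hI0] at hu1
    have hTu := eq_radial_factor hImono hT hu0 one_pos (by simpa using hu1)
    simp [hj, hTu, hxx]
  · intro x _
    simp [hj, hTw]
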